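/- Let U ⊆ R^d be bounded and w ∈ W^+(U) with w*(x,y) = w(y,x). Then the functional F: L^2(R^d, C) → R, f ↦ ‖f ⋆_w f‖²_{L^2}, is convex. -/

import Mathlib

open MeasureTheory Complex

/-- Weighted cross-correlation `(f ⋆_w g)(x) = ∫ f*(y) g(x+y) w(x+y, y) dy`. -/
noncomputable def wcc {d : ℕ} (f g : EuclideanSpace ℝ (Fin d) → ℂ)
    (w : EuclideanSpace ℝ (Fin d) → EuclideanSpace ℝ (Fin d) → ℂ)
    (x : EuclideanSpace ℝ (Fin d)) : ℂ :=
  ∫ y, (starRingEnd ℂ) (f y) * g (x + y) * w (x + y) y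

/-- The class `W⁺(U)`: bounded measurable weights supported in `U × U` that are uniform
limits of finite sums of factorized terms `v_j(x) v_j*(y)` with `v_j` bounded measurable. -/
def IsWPlus {d : ℕ} (U : Set (EuclideanSpace ℝ (Fin d)))
    (w : EuclideanSpace ℝ (Fin d) → EuclideanSpace ℝ (Fin d) → ℂ) : Prop :=
  Measurable (fun q : EuclideanSpace ℝ (Fin d) × EuclideanSpace ℝ (Fin d) => w q.1 q.2) ∧
  (∃ C : ℝ, ∀ x y, ‖w x y‖ ≤ C) ∧
  (∀ x y, x ∉ U ∨ y ∉ U → w x y = 0) ∧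
  ∀ ε : ℝ, 0 < ε → ∃ (N : ℕ) (v : Fin N → EuclideanSpace ℝ (Fin d) → ℂ),
    (∀ j, Measurable (v j) ∧ (∃ C : ℝ, ∀ x, ‖v j x‖ ≤ C) ∧ (∀ x, x ∉ U → v j x = 0)) ∧
    ∀ x y, ‖w x y - ∑ j, v j x * (starRingEnd ℂ) (v j y)‖ ≤ ε

/-- A jointly measurable weight bounded by `C` and supported in the square of the closed ball of
radius `R` around the origin. -/
structure IsBoundedWeight {d : ℕ} (R C : ℝ)
    (w : EuclideanSpace ℝ (Fin d) → EuclideanSpace ℝ (Fin d) → ℂ) : Prop where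
  measurable : Measurable
    (fun q : EuclideanSpace ℝ (Fin d) × EuclideanSpace ℝ (Fin d) => w q.1 q.2)
  norm_le : ∀ x y, ‖w x y‖ ≤ C
  eq_zero : ∀ x y, R < ‖x‖ ∨ R < ‖y‖ → w x y = 0

section

variable {d : ℕ} {R C : ℝ} {w : EuclideanSpace ℝ (Fin d) → EuclideanSpace ℝ (Fin d) → ℂ}
  {f g a b : EuclideanSpace ℝ (Fin d) → ℂ}

lemma IsBoundedWeight.nonneg (hw : IsBoundedWeight R C w) : 0 ≤ C :=
  (norm_nonneg _).trans (hw.norm_le 0 0)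

lemma IsBoundedWeight.norm_integrand_le (hw : IsBoundedWeight R C w)
    (x y : EuclideanSpace ℝ (Fin d)) :
    ‖(starRingEnd ℂ) (f y) * g (x + y) * w (x + y) y‖ ≤
      C * ((‖f y‖ ^ 2 + ‖g (x + y)‖ ^ 2) / 2) := by
  rw [norm_mul, norm_mul, RCLike.norm_conj, mul_comm C]
  refine mul_le_mul ?_ (hw.norm_le _ _) (norm_nonneg _) (by positivity)
  nlinarith [sq_nonneg (‖f y‖ - ‖g (x + y)‖)]

lemma integrable_sq_add_sq_translate (hf : Integrable (fun y => ‖f y‖ ^ 2))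
    (hg : Integrable (fun y => ‖g y‖ ^ 2)) (x : EuclideanSpace ℝ (Fin d)) :
    Integrable (fun y => (‖f y‖ ^ 2 + ‖g (x + y)‖ ^ 2) / 2) :=
  (hf.add (hg.comp_add_left x)).div_const 2

lemma IsBoundedWeight.integrable_integrand (hw : IsBoundedWeight R C w)
    (hfm : Measurable f) (hgm : Measurable g) (hf : Integrable (fun y => ‖f y‖ ^ 2))
    (hg : Integrable (fun y => ‖g y‖ ^ 2)) (x : EuclideanSpace ℝ (Fin d)) :
    Integrable (fun y => (starRingEnd ℂ) (f y) * g (x + y) * w (x + y) y) := by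
  refine ((integrable_sq_add_sq_translate hf hg x).const_mul C).mono' ?_
    (.of_forall fun y => hw.norm_integrand_le x y)
  have := hw.measurable.comp ((measurable_const_add x).prodMk measurable_id)
  exact (((continuous_conj.measurable.comp hfm).mul
    (hgm.comp (measurable_const_add x))).mul this).aestronglyMeasurable

lemma integral_sq_add_sq_translate (hf : Integrable (fun y => ‖f y‖ ^ 2))
    (x : EuclideanSpace ℝ (Fin d)) :
    ∫ y, (‖f y‖ ^ 2 + ‖f (x + y)‖ ^ 2) / 2 = ∫ y, ‖f y‖ ^ 2 := by
  rw [integral_div, integral_add hf (hf.comp_add_left x),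
    integral_add_left_eq_self (fun y => ‖f y‖ ^ 2) x]
  ring

lemma IsBoundedWeight.norm_wcc_le (hw : IsBoundedWeight R C w)
    (hf : Integrable (fun y => ‖f y‖ ^ 2)) (x : EuclideanSpace ℝ (Fin d)) :
    ‖wcc f f w x‖ ≤ C * ∫ y, ‖f y‖ ^ 2 := by
  rw [← integral_sq_add_sq_translate hf x, ← integral_const_mul]
  exact norm_integral_le_of_norm_le ((integrable_sq_add_sq_translate hf hf x).const_mul C)
    (.of_forall fun y => hw.norm_integrand_le x y)

lemma IsBoundedWeight.wcc_eq_zero (hw : IsBoundedWeight R C w)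
    {x : EuclideanSpace ℝ (Fin d)} (hx : x ∉ Metric.closedBall 0 (2 * R)) :
    wcc f g w x = 0 := by
  refine (integral_congr_ae (g := 0) (.of_forall fun y => ?_)).trans
    (integral_zero' _ _)
  have hxy : R < ‖x + y‖ ∨ R < ‖y‖ := by
    by_contra! h
    rw [mem_closedBall_zero_iff] at hx
    have := norm_sub_le (x + y) y
    rw [add_sub_cancel_right] at this
    linarith [h.1, h.2]
  simp [hw.eq_zero _ _ hxy]

lemma IsBoundedWeight.measurable_wcc (hw : IsBoundedWeight R C w)
    (hfm : Measurable f) (hgm : Measurable g) : Measurable (wcc f g w) := by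
  have h : Measurable (fun q : EuclideanSpace ℝ (Fin d) × EuclideanSpace ℝ (Fin d) =>
      (starRingEnd ℂ) (f q.2) * g (q.1 + q.2) * w (q.1 + q.2) q.2) := by
    have hadd : Measurable (fun q : EuclideanSpace ℝ (Fin d) × EuclideanSpace ℝ (Fin d) =>
      q.1 + q.2) := measurable_fst.add measurable_snd
    exact ((continuous_conj.measurable.comp (hfm.comp measurable_snd)).mul (hgm.comp hadd)).mul
      (hw.measurable.comp (hadd.prodMk measurable_snd))
  exact (h.stronglyMeasurable.integral_prod_right' (ν := volume)).measurable

lemma integrable_of_norm_le_of_eq_zero {E : Type*} [NormedAddCommGroup E]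
    {h : EuclideanSpace ℝ (Fin d) → E} {r M : ℝ}
    (hm : AEStronglyMeasurable h) (hb : ∀ x, ‖h x‖ ≤ M)
    (h0 : ∀ x, x ∉ Metric.closedBall 0 r → h x = 0) : Integrable h := by
  refine IntegrableOn.integrable_of_forall_notMem_eq_zero
    (s := Metric.closedBall 0 r) ?_ (fun x hx => h0 x hx)
  exact Measure.integrableOn_of_bounded measure_closedBall_lt_top.ne hm (.of_forall hb)

lemma IsBoundedWeight.integrable_wcc_sq (hw : IsBoundedWeight R C w) (hfm : Measurable f)
    (hf : Integrable (fun y => ‖f y‖ ^ 2)) : Integrable (fun x => ‖wcc f f w x‖ ^ 2) := by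
  refine integrable_of_norm_le_of_eq_zero (r := 2 * R) (M := (C * ∫ y, ‖f y‖ ^ 2) ^ 2)
    ((hw.measurable_wcc hfm hfm).norm.pow_const 2).aestronglyMeasurable
    (fun x => ?_) (fun x hx => by simp [hw.wcc_eq_zero hx])
  rw [norm_pow, norm_norm]
  exact pow_le_pow_left₀ (norm_nonneg _) (hw.norm_wcc_le hf x) 2

lemma IsBoundedWeight.norm_wcc_mul_conj_wcc_le {R' C' : ℝ}
    {w' : EuclideanSpace ℝ (Fin d) → EuclideanSpace ℝ (Fin d) → ℂ} (hw : IsBoundedWeight R C w)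
    (hw' : IsBoundedWeight R' C' w') (ha : Integrable (fun y => ‖a y‖ ^ 2))
    (hb : Integrable (fun y => ‖b y‖ ^ 2)) (x : EuclideanSpace ℝ (Fin d)) :
    ‖wcc a a w x * (starRingEnd ℂ) (wcc b b w' x)‖ ≤
      (C * ∫ y, ‖a y‖ ^ 2) * (C' * ∫ y, ‖b y‖ ^ 2) := by
  rw [norm_mul, RCLike.norm_conj]
  exact mul_le_mul (hw.norm_wcc_le ha x) (hw'.norm_wcc_le hb x) (norm_nonneg _)
    (mul_nonneg hw.nonneg (integral_nonneg fun _ => by positivity))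

lemma IsBoundedWeight.integrable_wcc_mul_conj_wcc {R' C' : ℝ}
    {w' : EuclideanSpace ℝ (Fin d) → EuclideanSpace ℝ (Fin d) → ℂ} (hw : IsBoundedWeight R C w)
    (hw' : IsBoundedWeight R' C' w') (ham : Measurable a) (hbm : Measurable b)
    (ha : Integrable (fun y => ‖a y‖ ^ 2)) (hb : Integrable (fun y => ‖b y‖ ^ 2)) :
    Integrable (fun x => wcc a a w x * (starRingEnd ℂ) (wcc b b w' x)) :=
  integrable_of_norm_le_of_eq_zero (r := 2 * R)
    ((hw.measurable_wcc ham ham).mul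
      (continuous_conj.measurable.comp (hw'.measurable_wcc hbm hbm))).aestronglyMeasurable
    (hw.norm_wcc_mul_conj_wcc_le hw' ha hb) (fun x hx => by simp [hw.wcc_eq_zero hx])

/-- The kernel of the quadrilinear form `⟨a ⋆ a, b ⋆ b⟩ = ‖a ⋆ b‖²` is integrable. -/
lemma integrable_crossCorrelation_kernel (ham : Measurable a) (hbm : Measurable b)
    (ha1 : Integrable a) (hb : Integrable (fun y => ‖b y‖ ^ 2)) :
    Integrable (fun q : (EuclideanSpace ℝ (Fin d) × EuclideanSpace ℝ (Fin d)) ×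
        EuclideanSpace ℝ (Fin d) =>
      ((starRingEnd ℂ) (a q.1.1) * a q.1.2) *
        (b (q.1.1 + q.2) * (starRingEnd ℂ) (b (q.1.2 + q.2))))
      ((volume.prod volume).prod volume) := by
  have hconj : Measurable (starRingEnd ℂ) := continuous_conj.measurable
  have hm : Measurable (fun q : (EuclideanSpace ℝ (Fin d) × EuclideanSpace ℝ (Fin d)) ×
        EuclideanSpace ℝ (Fin d) =>
      ((starRingEnd ℂ) (a q.1.1) * a q.1.2) *
        (b (q.1.1 + q.2) * (starRingEnd ℂ) (b (q.1.2 + q.2)))) := by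
    fun_prop
  have hbound (y z : EuclideanSpace ℝ (Fin d)) :
      Integrable (fun s => (‖b (y + s)‖ ^ 2 + ‖b (z + s)‖ ^ 2) / 2) :=
    ((hb.comp_add_left y).add (hb.comp_add_left z)).div_const 2
  have hle (y z s : EuclideanSpace ℝ (Fin d)) :
      ‖((starRingEnd ℂ) (a y) * a z) * (b (y + s) * (starRingEnd ℂ) (b (z + s)))‖ ≤
        (‖a y‖ * ‖a z‖) * ((‖b (y + s)‖ ^ 2 + ‖b (z + s)‖ ^ 2) / 2) := by
    simp only [norm_mul, RCLike.norm_conj]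
    gcongr
    nlinarith [sq_nonneg (‖b (y + s)‖ - ‖b (z + s)‖)]
  rw [integrable_prod_iff hm.aestronglyMeasurable]
  refine ⟨.of_forall fun p => ((hbound p.1 p.2).const_mul (‖a p.1‖ * ‖a p.2‖)).mono'
    (hm.comp measurable_prodMk_left).aestronglyMeasurable
    (.of_forall fun s => hle p.1 p.2 s), ?_⟩
  refine ((ha1.norm.mul_prod ha1.norm).mul_const (∫ y, ‖b y‖ ^ 2)).mono'
    hm.norm.stronglyMeasurable.integral_prod_right'.aestronglyMeasurable
    (.of_forall fun p => ?_)
  rw [Real.norm_of_nonneg (integral_nonneg fun _ => norm_nonneg _)]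
  refine (integral_mono_of_nonneg (.of_forall fun _ => norm_nonneg _)
    ((hbound p.1 p.2).const_mul (‖a p.1‖ * ‖a p.2‖))
    (.of_forall fun s => hle p.1 p.2 s)).trans_eq ?_
  rw [integral_const_mul, integral_div,
    integral_add (hb.comp_add_left p.1) (hb.comp_add_left p.2),
    integral_add_left_eq_self (fun y => ‖b y‖ ^ 2) p.1,
    integral_add_left_eq_self (fun y => ‖b y‖ ^ 2) p.2]
  ring

lemma norm_sq_crossCorrelation (s : EuclideanSpace ℝ (Fin d)) :
    ((‖∫ y, (starRingEnd ℂ) (a y) * b (y + s)‖ ^ 2 : ℝ) : ℂ) =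
      ∫ p : EuclideanSpace ℝ (Fin d) × EuclideanSpace ℝ (Fin d),
        ((starRingEnd ℂ) (a p.1) * a p.2) *
          (b (p.1 + s) * (starRingEnd ℂ) (b (p.2 + s))) ∂(volume.prod volume) := by
  have := integral_prod_mul (μ := (volume : Measure (EuclideanSpace ℝ (Fin d))))
    (ν := (volume : Measure (EuclideanSpace ℝ (Fin d))))
    (fun y => (starRingEnd ℂ) (a y) * b (y + s))
    (fun z => a z * (starRingEnd ℂ) (b (z + s)))
  rw [ofReal_pow, ← mul_conj', ← integral_conj]
  simp only [map_mul, conj_conj]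
  rw [← this]
  exact integral_congr_ae (.of_forall fun p => by ring)

lemma integral_translate_mul_conj (c : ℂ) (y z : EuclideanSpace ℝ (Fin d)) :
    ∫ s, c * (b (y + s) * (starRingEnd ℂ) (b (z + s))) =
      c * (starRingEnd ℂ) (∫ s, (starRingEnd ℂ) (b s) * b (z - y + s)) := by
  rw [integral_const_mul, ← integral_conj,
    ← integral_add_left_eq_self (fun s => (starRingEnd ℂ) ((starRingEnd ℂ) (b s) *
      b (z - y + s))) y]
  simp [← add_assoc]

/-- Integrating `conj (a y) * a z * k (z - y)` amounts to integrating the autocorrelation of `a`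
against `k`. -/
lemma integral_autocorrelation_mul {k : EuclideanSpace ℝ (Fin d) → ℂ}
    (hk : Integrable (fun p : EuclideanSpace ℝ (Fin d) × EuclideanSpace ℝ (Fin d) =>
      ((starRingEnd ℂ) (a p.1) * a p.2) * k (p.2 - p.1)) (volume.prod volume)) :
    ∫ x, (∫ y, (starRingEnd ℂ) (a y) * a (x + y)) * k x =
      ∫ p : EuclideanSpace ℝ (Fin d) × EuclideanSpace ℝ (Fin d),
        ((starRingEnd ℂ) (a p.1) * a p.2) * k (p.2 - p.1) ∂(volume.prod volume) := by
  have hshear := (measurePreserving_prod_add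
    (volume : Measure (EuclideanSpace ℝ (Fin d))) volume).integrable_comp_of_integrable hk
  simp only [Function.comp_def, add_sub_cancel_left] at hshear
  rw [integral_prod _ hk]
  calc _ = ∫ x, ∫ y, ((starRingEnd ℂ) (a y) * a (y + x)) * k x := by
        simp only [integral_mul_const, add_comm]
    _ = ∫ y, ∫ x, ((starRingEnd ℂ) (a y) * a (y + x)) * k x :=
        (integral_integral_swap hshear).symm
    _ = _ := by
        congr 1 with y
        rw [← integral_add_left_eq_self
          (fun z => ((starRingEnd ℂ) (a y) * a z) * k (z - y)) y]
        simp only [add_sub_cancel_left]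

/-- The pairing of two autocorrelations is the squared norm of the cross-correlation. -/
lemma integral_autocorrelation_mul_conj (ham : Measurable a) (hbm : Measurable b)
    (ha1 : Integrable a) (hb : Integrable (fun y => ‖b y‖ ^ 2)) :
    ∫ x, (∫ y, (starRingEnd ℂ) (a y) * a (x + y)) *
        (starRingEnd ℂ) (∫ y, (starRingEnd ℂ) (b y) * b (x + y)) =
      ∫ s, ((‖∫ y, (starRingEnd ℂ) (a y) * b (y + s)‖ ^ 2 : ℝ) : ℂ) := by
  have hG := integrable_crossCorrelation_kernel ham hbm ha1 hb
  have hinner (p : EuclideanSpace ℝ (Fin d) × EuclideanSpace ℝ (Fin d)) :=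
    integral_translate_mul_conj (b := b) ((starRingEnd ℂ) (a p.1) * a p.2) p.1 p.2
  have hp : Integrable (fun p : EuclideanSpace ℝ (Fin d) × EuclideanSpace ℝ (Fin d) =>
      ((starRingEnd ℂ) (a p.1) * a p.2) *
        (starRingEnd ℂ) (∫ y, (starRingEnd ℂ) (b y) * b (p.2 - p.1 + y)))
      (volume.prod volume) :=
    hG.integral_prod_left.congr (.of_forall hinner)
  rw [integral_autocorrelation_mul
    (k := fun x => (starRingEnd ℂ) (∫ y, (starRingEnd ℂ) (b y) * b (x + y))) hp]
  simp only [norm_sq_crossCorrelation, ← hinner]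
  exact integral_integral_swap hG

/-- A bounded factor supported in a ball gives a bounded factorized weight. -/
lemma isBoundedWeight_factorized {v : EuclideanSpace ℝ (Fin d) → ℂ} {M : ℝ}
    (hvm : Measurable v) (hvM : ∀ x, ‖v x‖ ≤ M) (hv0 : ∀ x, R < ‖x‖ → v x = 0) :
    IsBoundedWeight R (M * M) (fun x y => v x * (starRingEnd ℂ) (v y)) where
  measurable := (hvm.comp measurable_fst).mul
    (continuous_conj.measurable.comp (hvm.comp measurable_snd))
  norm_le x y := by
    rw [norm_mul, RCLike.norm_conj]
    exact mul_le_mul (hvM x) (hvM y) (norm_nonneg _) ((norm_nonneg _).trans (hvM x))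
  eq_zero x y h := by
    rcases h with h | h <;> simp [hv0 _ h]

lemma integrable_mul_sq {v : EuclideanSpace ℝ (Fin d) → ℂ} {M : ℝ}
    (hvm : Measurable v) (hvM : ∀ x, ‖v x‖ ≤ M) (ham : Measurable a)
    (ha : Integrable (fun y => ‖a y‖ ^ 2)) : Integrable (fun y => ‖v y * a y‖ ^ 2) := by
  refine (ha.const_mul (M ^ 2)).mono' ((hvm.mul ham).norm.pow_const 2).aestronglyMeasurable
    (.of_forall fun y => ?_)
  rw [norm_pow, norm_norm, norm_mul, mul_pow]
  gcongr
  exact hvM y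

lemma integrable_mul_of_eq_zero {v : EuclideanSpace ℝ (Fin d) → ℂ} {M : ℝ}
    (hvm : Measurable v) (hvM : ∀ x, ‖v x‖ ≤ M) (hv0 : ∀ x, R < ‖x‖ → v x = 0)
    (ham : Measurable a) (ha : Integrable (fun y => ‖a y‖ ^ 2)) :
    Integrable (fun y => v y * a y) := by
  have hv2 : Integrable (fun y => ‖v y‖ ^ 2) :=
    integrable_of_norm_le_of_eq_zero (r := R) (M := M ^ 2)
      (hvm.norm.pow_const 2).aestronglyMeasurable
      (fun x => by
        rw [norm_pow, norm_norm]
        exact pow_le_pow_left₀ (norm_nonneg _) (hvM x) 2)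
      (fun x hx => by simp [hv0 x (by simpa using hx)])
  refine (hv2.add ha).mono' (hvm.mul ham).aestronglyMeasurable (.of_forall fun y => ?_)
  rw [norm_mul, Pi.add_apply]
  nlinarith [sq_nonneg (‖v y‖ - ‖a y‖), sq_nonneg (‖v y‖), sq_nonneg (‖a y‖)]

lemma wcc_factorized (v : EuclideanSpace ℝ (Fin d) → ℂ) (x : EuclideanSpace ℝ (Fin d)) :
    wcc a a (fun x y => v x * (starRingEnd ℂ) (v y)) x =
      ∫ y, (starRingEnd ℂ) (v y * a y) * (v (x + y) * a (x + y)) :=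
  integral_congr_ae (.of_forall fun y => by simp only [map_mul]; ring)

lemma integral_wcc_factorized_nonneg {v v' : EuclideanSpace ℝ (Fin d) → ℂ} {M M' : ℝ}
    (hvm : Measurable v) (hvM : ∀ x, ‖v x‖ ≤ M) (hv0 : ∀ x, R < ‖x‖ → v x = 0)
    (hvm' : Measurable v') (hvM' : ∀ x, ‖v' x‖ ≤ M')
    (ham : Measurable a) (hbm : Measurable b)
    (ha : Integrable (fun y => ‖a y‖ ^ 2)) (hb : Integrable (fun y => ‖b y‖ ^ 2)) :
    0 ≤ (∫ x, wcc a a (fun x y => v x * (starRingEnd ℂ) (v y)) x *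
      (starRingEnd ℂ) (wcc b b (fun x y => v' x * (starRingEnd ℂ) (v' y)) x)).re := by
  simp only [wcc_factorized]
  rw [integral_autocorrelation_mul_conj (a := fun y => v y * a y) (b := fun y => v' y * b y)
    (hvm.mul ham) (hvm'.mul hbm) (integrable_mul_of_eq_zero hvm hvM hv0 ham ha)
    (integrable_mul_sq hvm' hvM' hbm hb)]
  rw [integral_complex_ofReal, ofReal_re]
  exact integral_nonneg fun _ => by positivity

lemma integral_wcc_sum_nonneg {N : ℕ} {v : Fin N → EuclideanSpace ℝ (Fin d) → ℂ}
    (hvm : ∀ j, Measurable (v j)) (hvM : ∀ j, ∃ M : ℝ, ∀ x, ‖v j x‖ ≤ M)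
    (hv0 : ∀ j x, R < ‖x‖ → v j x = 0) (ham : Measurable a) (hbm : Measurable b)
    (ha : Integrable (fun y => ‖a y‖ ^ 2)) (hb : Integrable (fun y => ‖b y‖ ^ 2)) :
    0 ≤ (∫ x, wcc a a (fun x y => ∑ j, v j x * (starRingEnd ℂ) (v j y)) x *
      (starRingEnd ℂ) (wcc b b (fun x y => ∑ j, v j x * (starRingEnd ℂ) (v j y)) x)).re := by
  choose M hM using hvM
  have hw j := isBoundedWeight_factorized (hvm j) (hM j) (hv0 j)
  have hsum {h : EuclideanSpace ℝ (Fin d) → ℂ} (hm : Measurable h)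
      (hi : Integrable (fun y => ‖h y‖ ^ 2)) (x : EuclideanSpace ℝ (Fin d)) :
      wcc h h (fun x y => ∑ j, v j x * (starRingEnd ℂ) (v j y)) x =
        ∑ j, wcc h h (fun x y => v j x * (starRingEnd ℂ) (v j y)) x := by
    unfold wcc
    rw [← integral_finsetSum _ fun j _ => (hw j).integrable_integrand hm hm hi hi x]
    simp only [Finset.mul_sum]
  simp only [hsum ham ha, hsum hbm hb, map_sum, Finset.sum_mul_sum]
  have hint j k := (hw j).integrable_wcc_mul_conj_wcc (hw k) ham hbm ha hb
  rw [integral_finsetSum _ fun j _ => integrable_finsetSum _ fun k _ => hint j k, re_sum]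
  refine Finset.sum_nonneg fun j _ => ?_
  rw [integral_finsetSum _ fun k _ => hint j k, re_sum]
  exact Finset.sum_nonneg fun k _ => integral_wcc_factorized_nonneg (hvm j) (hM j) (hv0 j)
    (hvm k) (hM k) ham hbm ha hb

lemma IsWPlus.exists_isBoundedWeight {U : Set (EuclideanSpace ℝ (Fin d))}
    (hUR : ∀ x, R < ‖x‖ → x ∉ U) (hw : IsWPlus U w) : ∃ C, IsBoundedWeight R C w := by
  obtain ⟨hm, ⟨C, hC⟩, h0, -⟩ := hw
  exact ⟨C, hm, hC, fun x y h => h0 x y (h.imp (hUR x) (hUR y))⟩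

lemma IsBoundedWeight.sub {C' : ℝ}
    {w' : EuclideanSpace ℝ (Fin d) → EuclideanSpace ℝ (Fin d) → ℂ} {ε : ℝ}
    (hw : IsBoundedWeight R C w) (hw' : IsBoundedWeight R C' w')
    (hε : ∀ x y, ‖w x y - w' x y‖ ≤ ε) :
    IsBoundedWeight R ε (fun x y => w x y - w' x y) where
  measurable := hw.measurable.sub hw'.measurable
  norm_le := hε
  eq_zero x y h := by rw [hw.eq_zero x y h, hw'.eq_zero x y h, sub_zero]

lemma IsBoundedWeight.wcc_sub {C' : ℝ}
    {w' : EuclideanSpace ℝ (Fin d) → EuclideanSpace ℝ (Fin d) → ℂ}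
    (hw : IsBoundedWeight R C w) (hw' : IsBoundedWeight R C' w')
    (hfm : Measurable f) (hf : Integrable (fun y => ‖f y‖ ^ 2)) (x : EuclideanSpace ℝ (Fin d)) :
    wcc f f (fun x y => w x y - w' x y) x = wcc f f w x - wcc f f w' x := by
  unfold wcc
  rw [← integral_sub (hw.integrable_integrand hfm hfm hf hf x)
    (hw'.integrable_integrand hfm hfm hf hf x)]
  simp only [mul_sub]

lemma IsWPlus.integral_wcc_mul_conj_wcc_nonneg {U : Set (EuclideanSpace ℝ (Fin d))}
    (hUR : ∀ x, R < ‖x‖ → x ∉ U) (hw : IsWPlus U w) (ham : Measurable a) (hbm : Measurable b)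
    (ha : Integrable (fun y => ‖a y‖ ^ 2)) (hb : Integrable (fun y => ‖b y‖ ^ 2)) :
    0 ≤ (∫ x, wcc a a w x * (starRingEnd ℂ) (wcc b b w x)).re := by
  obtain ⟨C, hC⟩ := hw.exists_isBoundedWeight hUR
  choose N v hv hvε using fun n : ℕ => hw.2.2.2 (1 / ((n : ℝ) + 1)) (by positivity)
  set u : ℕ → EuclideanSpace ℝ (Fin d) → EuclideanSpace ℝ (Fin d) → ℂ :=
    fun n x y => ∑ j, v n j x * (starRingEnd ℂ) (v n j y) with hu
  have hv0 (n : ℕ) (j : Fin (N n)) (x : EuclideanSpace ℝ (Fin d)) (hx : R < ‖x‖) :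
      v n j x = 0 := (hv n j).2.2 x (hUR x hx)
  have hub (n : ℕ) : IsBoundedWeight R (C + 1) (u n) := by
    refine ⟨Finset.measurable_fun_sum _ fun j _ =>
      ((hv n j).1.comp measurable_fst).mul
        (continuous_conj.measurable.comp ((hv n j).1.comp measurable_snd)), fun x y => ?_,
      fun x y h => Finset.sum_eq_zero fun j _ => ?_⟩
    · have h1 : 1 / ((n : ℝ) + 1) ≤ 1 := by
        rw [div_le_one (by positivity)]
        linarith [n.cast_nonneg (α := ℝ)]
      have := norm_sub_norm_le (u n x y) (w x y)
      rw [norm_sub_rev] at this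
      linarith [hvε n x y, hC.norm_le x y]
    · rcases h with h | h <;> simp [hv0 n j _ h]
  have hlim {h : EuclideanSpace ℝ (Fin d) → ℂ} (hm : Measurable h)
      (hi : Integrable (fun y => ‖h y‖ ^ 2)) (x : EuclideanSpace ℝ (Fin d)) :
      Filter.Tendsto (fun n => wcc h h (u n) x) Filter.atTop (nhds (wcc h h w x)) := by
    rw [tendsto_iff_norm_sub_tendsto_zero]
    refine squeeze_zero (fun _ => norm_nonneg _) (fun n => ?_)
      (by simpa using tendsto_one_div_add_atTop_nhds_zero_nat.mul_const (∫ y, ‖h y‖ ^ 2))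
    rw [norm_sub_rev, ← hC.wcc_sub (hub n) hm hi]
    simpa using (hC.sub (hub n) (hvε n)).norm_wcc_le hi x
  have htend : Filter.Tendsto
      (fun n => ∫ x, wcc a a (u n) x * (starRingEnd ℂ) (wcc b b (u n) x)) Filter.atTop
      (nhds (∫ x, wcc a a w x * (starRingEnd ℂ) (wcc b b w x))) := by
    refine tendsto_integral_of_dominated_convergence
      ((Metric.closedBall 0 (2 * R)).indicator fun _ =>
        ((C + 1) * ∫ y, ‖a y‖ ^ 2) * ((C + 1) * ∫ y, ‖b y‖ ^ 2))
      (fun n => ((hub n).integrable_wcc_mul_conj_wcc (hub n) ham hbm ha hb).1)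
      ((integrable_indicator_iff measurableSet_closedBall).2
        (integrableOn_const measure_closedBall_lt_top.ne))
      (fun n => .of_forall fun x => ?_)
      (.of_forall fun x => (hlim ham ha x).mul
        ((continuous_conj.tendsto _).comp (hlim hbm hb x)))
    by_cases hx : x ∈ Metric.closedBall 0 (2 * R)
    · rw [Set.indicator_of_mem hx]
      exact (hub n).norm_wcc_mul_conj_wcc_le (hub n) ha hb x
    · rw [Set.indicator_of_notMem hx]
      simp [(hub n).wcc_eq_zero hx]
  exact ge_of_tendsto' ((continuous_re.tendsto _).comp htend) fun n =>
    integral_wcc_sum_nonneg (fun j => (hv n j).1) (fun j => (hv n j).2.1) (hv0 n) ham hbm ha hb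

lemma IsBoundedWeight.toReal_eLpNorm_wcc_sq (hw : IsBoundedWeight R C w) (hfm : Measurable f)
    (hf : Integrable (fun y => ‖f y‖ ^ 2)) :
    ((eLpNorm (wcc f f w) 2 volume).toReal) ^ 2 = ∫ x, ‖wcc f f w x‖ ^ 2 := by
  have hmem : MemLp (wcc f f w) 2 volume :=
    (memLp_two_iff_integrable_sq_norm (hw.measurable_wcc hfm hfm).aestronglyMeasurable).2
      (hw.integrable_wcc_sq hfm hf)
  have h0 : 0 ≤ ∫ x, ‖wcc f f w x‖ ^ 2 := integral_nonneg fun _ => by positivity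
  rw [hmem.eLpNorm_eq_integral_rpow_norm (by norm_num) (by norm_num)]
  simp only [ENNReal.toReal_ofNat, Real.rpow_ofNat]
  rw [ENNReal.toReal_ofReal (by positivity), ← Real.rpow_natCast, ← Real.rpow_mul h0]
  norm_num

lemma wcc_congr_ae (h : f =ᵐ[volume] g) : wcc f f w = wcc g g w := by
  ext x
  refine integral_congr_ae ?_
  filter_upwards [h, (measurePreserving_add_left volume x).quasiMeasurePreserving.ae_eq h]
    with y hy hxy
  simp only [Function.comp_apply] at hxy
  rw [hy, hxy]

/-- The quadratic map `f ↦ f ⋆_w f` along a segment. -/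
lemma IsBoundedWeight.wcc_segment (hw : IsBoundedWeight R C w)
    (hfm : Measurable f) (hgm : Measurable g) (hf : Integrable (fun y => ‖f y‖ ^ 2))
    (hg : Integrable (fun y => ‖g y‖ ^ 2)) {s t : ℝ} (hst : s + t = 1)
    (hm : Integrable (fun y => ‖s • f y + t • g y‖ ^ 2))
    (hd : Integrable (fun y => ‖f y - g y‖ ^ 2)) (x : EuclideanSpace ℝ (Fin d)) :
    wcc (fun y => s • f y + t • g y) (fun y => s • f y + t • g y) w x +
        (s * t : ℝ) • wcc (fun y => f y - g y) (fun y => f y - g y) w x =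
      s • wcc f f w x + t • wcc g g w x := by
  have hmm : Measurable (fun y => s • f y + t • g y) := (hfm.const_smul s).add (hgm.const_smul t)
  have hdm : Measurable (fun y => f y - g y) := hfm.sub hgm
  have hsmul {k : EuclideanSpace ℝ (Fin d) → ℂ} (hk : Integrable k) (c : ℝ) :
      Integrable (fun y => c • k y) := hk.smul c
  unfold wcc
  simp only [← integral_smul]
  rw [← integral_add (hw.integrable_integrand hmm hmm hm hm x)
      (hsmul (hw.integrable_integrand hdm hdm hd hd x) (s * t)),
    ← integral_add (hsmul (hw.integrable_integrand hfm hfm hf hf x) s)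
      (hsmul (hw.integrable_integrand hgm hgm hg hg x) t)]
  congr 1 with y
  obtain rfl : t = 1 - s := by linarith
  simp only [real_smul, map_add, map_sub, map_mul, conj_ofReal]
  push_cast
  ring

lemma norm_sq_add_inner_le {p q m r : ℂ} {s t : ℝ} (hs : 0 ≤ s) (ht : 0 ≤ t) (hst : s + t = 1)
    (h : m + (s * t : ℝ) • r = s • p + t • q) :
    ‖m‖ ^ 2 + 2 * (s * t) * (m * (starRingEnd ℂ) r).re ≤ s * ‖p‖ ^ 2 + t * ‖q‖ ^ 2 := by
  obtain rfl : m = s • p + t • q - (s * t : ℝ) • r := by rw [← h]; ring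
  obtain rfl : t = 1 - s := by linarith
  have hst0 := mul_nonneg hs ht
  simp only [← normSq_eq_norm_sq, normSq_apply, mul_re, sub_re, sub_im, add_re, add_im,
    conj_re, conj_im, smul_re, smul_im, smul_eq_mul]
  nlinarith [mul_nonneg hst0 (sq_nonneg (p.re - q.re)), mul_nonneg hst0 (sq_nonneg (p.im - q.im)),
    sq_nonneg (s * (1 - s) * r.re), sq_nonneg (s * (1 - s) * r.im)]

lemma integrable_sq_coe_Lp (f : Lp ℂ 2 (volume : Measure (EuclideanSpace ℝ (Fin d)))) :
    Integrable (fun y => ‖f y‖ ^ 2) :=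
  (memLp_two_iff_integrable_sq_norm (Lp.memLp f).1).1 (Lp.memLp f)

end

theorem stmt8 {d : ℕ} (U : Set (EuclideanSpace ℝ (Fin d))) (hUb : Bornology.IsBounded U)
    (w : EuclideanSpace ℝ (Fin d) → EuclideanSpace ℝ (Fin d) → ℂ)
    (hw : IsWPlus U w)
    (hsym : ∀ x y, (starRingEnd ℂ) (w x y) = w y x) :
    ConvexOn ℝ Set.univ
      (fun f : Lp ℂ 2 (volume : Measure (EuclideanSpace ℝ (Fin d))) =>
        ((eLpNorm (wcc (⇑f) (⇑f) w) 2 volume).toReal) ^ 2) := by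
  obtain ⟨R, hR⟩ := hUb.exists_norm_le
  have hUR : ∀ x, R < ‖x‖ → x ∉ U := fun x hx hxU => (hR x hxU).not_gt hx
  obtain ⟨C, hC⟩ := hw.exists_isBoundedWeight hUR
  refine ⟨convex_univ, fun f _ g _ s t hs ht hst => ?_⟩
  have hfm : Measurable f := (Lp.stronglyMeasurable f).measurable
  have hgm : Measurable g := (Lp.stronglyMeasurable g).measurable
  have hmm : Measurable (fun y => s • f y + t • g y) := (hfm.const_smul s).add (hgm.const_smul t)
  have hdm : Measurable (fun y => f y - g y) := hfm.sub hgm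
  have hf := integrable_sq_coe_Lp f
  have hg := integrable_sq_coe_Lp g
  have hmix : ⇑(s • f + t • g) =ᵐ[volume] fun y => s • f y + t • g y := by
    filter_upwards [Lp.coeFn_add (s • f) (t • g), Lp.coeFn_smul s f, Lp.coeFn_smul t g]
      with y h1 h2 h3
    rw [h1, Pi.add_apply, h2, h3, Pi.smul_apply, Pi.smul_apply]
  have hm : Integrable (fun y => ‖s • f y + t • g y‖ ^ 2) :=
    (integrable_sq_coe_Lp (s • f + t • g)).congr (hmix.mono fun y hy => by simp only [hy])
  have hd : Integrable (fun y => ‖f y - g y‖ ^ 2) :=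
    (integrable_sq_coe_Lp (f - g)).congr
      ((Lp.coeFn_sub f g).mono fun y hy => by simp only [hy, Pi.sub_apply])
  have hpos := hw.integral_wcc_mul_conj_wcc_nonneg hUR hmm hdm hm hd
  have hcross := hC.integrable_wcc_mul_conj_wcc hC hmm hdm hm hd
  simp only [smul_eq_mul]
  rw [wcc_congr_ae hmix, hC.toReal_eLpNorm_wcc_sq hmm hm, hC.toReal_eLpNorm_wcc_sq hfm hf,
    hC.toReal_eLpNorm_wcc_sq hgm hg]
  have hle := integral_mono
    ((hC.integrable_wcc_sq hmm hm).add (hcross.re.const_mul (2 * (s * t))))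
    (((hC.integrable_wcc_sq hfm hf).const_mul s).add ((hC.integrable_wcc_sq hgm hg).const_mul t))
    fun x => norm_sq_add_inner_le hs ht hst (hC.wcc_segment hfm hgm hf hg hst hm hd x)
  simp only [Pi.add_apply] at hle
  rw [integral_add (hC.integrable_wcc_sq hmm hm) (hcross.re.const_mul (2 * (s * t))),
    integral_add ((hC.integrable_wcc_sq hfm hf).const_mul s)
      ((hC.integrable_wcc_sq hgm hg).const_mul t), integral_const_mul, integral_const_mul,
    integral_const_mul, integral_re hcross] at hle
  have := mul_nonneg (mul_nonneg zero_le_two (mul_nonneg hs ht)) hpos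
  simp only [RCLike.re_eq_complex_re] at hle
  linarith
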